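/- Let M be a nonempty finite set of items, let v be a normalized, monotone, subadditive valuation on M, and let δ' = max_{e ∈ M} (v(M) − v(M∖{e})) be the maximum marginal value of a single item with respect to M. Then ω(S_q, M, v) ≥ (v(M) − δ')/2. -/

import Mathlib

open Finset

/-- The value, for player `p`, of the alternating picking game with `v` the valuation of `p`,
`R` the remaining items, `T` the set of items already picked by `p`, where the Bool indicates
whether it is `p`'s turn (`true`) or `q`'s turn (`false`). The first (fuel) argument is
intended to be `R.card`, so the recursion bottoms out exactly when `R = ∅`. -/
noncomputable def pickVal {α : Type*} [DecidableEq α] (v : Finset α → ℝ) :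
    ℕ → Bool → Finset α → Finset α → ℝ
  | 0, _, _, T => v T
  | k + 1, b, R, T =>
    if hR : R.Nonempty then
      if b then
        (R.image fun e => pickVal v k false (R.erase e) (insert e T)).max' (hR.image _)
      else
        (R.image fun e => pickVal v k true (R.erase e) T).min' (hR.image _)
    else v T

/-- `ω(S_p, M, v)`: the maximin value that player `p` can guarantee in the alternating
picking game over `M` in which `p` picks first. -/
noncomputable def omegaP {α : Type*} [DecidableEq α] (M : Finset α) (v : Finset α → ℝ) : ℝ :=
  pickVal v M.card true M ∅

/-- `ω(S_q, M, v)`: the maximin value that player `p` can guarantee in the alternating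
picking game over `M` in which `q` picks first. -/
noncomputable def omegaQ {α : Type*} [DecidableEq α] (M : Finset α) (v : Finset α → ℝ) : ℝ :=
  pickVal v M.card false M ∅

/-- A valuation on `M`: normalized, monotone, and subadditive. -/
def IsValuation {α : Type*} [DecidableEq α] (M : Finset α) (v : Finset α → ℝ) : Prop :=
  v ∅ = 0 ∧ (∀ S T : Finset α, S ⊆ T → T ⊆ M → v S ≤ v T) ∧
    ∀ S T : Finset α, S ⊆ M → T ⊆ M → v (S ∪ T) ≤ v S + v T

theorem nonempty_of_card_eq_succ {α : Type*} {k : ℕ} {R : Finset α} (h : R.card = k + 1) :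
    R.Nonempty :=
  Finset.card_pos.1 (by omega)

section PickingGame

variable {α : Type*} [DecidableEq α] {M : Finset α} {v : Finset α → ℝ}

theorem pickVal_false_le_pickVal_true (k : ℕ) {R : Finset α} (T : Finset α) {e : α} (he : e ∈ R) :
    pickVal v k false (R.erase e) (insert e T) ≤ pickVal v (k + 1) true R T := by
  have hR : R.Nonempty := ⟨e, he⟩
  simp only [pickVal, hR, dite_true, if_true]
  exact Finset.le_max' _ _ (Finset.mem_image_of_mem
    (fun e => pickVal v k false (R.erase e) (insert e T)) he)

theorem pickVal_false_succ_le (k : ℕ) {R : Finset α} (T : Finset α) {e : α} (he : e ∈ R) :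
    pickVal v (k + 1) false R T ≤ pickVal v k true (R.erase e) T := by
  have hR : R.Nonempty := ⟨e, he⟩
  simp only [pickVal, hR, dite_true, Bool.false_eq_true, if_false]
  exact Finset.min'_le _ _ (Finset.mem_image_of_mem _ he)

theorem exists_pickVal_true_eq (k : ℕ) {R : Finset α} (T : Finset α) (hR : R.Nonempty) :
    ∃ e ∈ R, pickVal v k false (R.erase e) (insert e T) = pickVal v (k + 1) true R T := by
  simp only [pickVal, hR, dite_true, if_true]
  exact Finset.mem_image.1 (Finset.max'_mem _ _)

theorem exists_pickVal_false_eq (k : ℕ) {R : Finset α} (T : Finset α) (hR : R.Nonempty) :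
    ∃ e ∈ R, pickVal v k true (R.erase e) T = pickVal v (k + 1) false R T := by
  simp only [pickVal, hR, dite_true, Bool.false_eq_true, if_false]
  exact Finset.mem_image.1 (Finset.min'_mem _ _)

theorem card_erase_eq_of_card_eq_succ {k : ℕ} {R : Finset α} {e : α} (h : R.card = k + 1)
    (he : e ∈ R) : (R.erase e).card = k := by
  rw [Finset.card_erase_of_mem he, h, Nat.add_sub_cancel]

/-- The two players, both using `v`, cannot both be held below a total of `v` of all items. -/
theorem IsValuation.le_pickVal_add_pickVal (hv : IsValuation M v) (k : ℕ) :
    ∀ R A B : Finset α, R.card = k → R ∪ A ∪ B ⊆ M →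
      v (R ∪ A ∪ B) ≤ pickVal v k true R A + pickVal v k false R B := by
  induction k with
  | zero =>
    intro R A B hR hM
    obtain rfl := Finset.card_eq_zero.1 hR
    rw [Finset.empty_union] at hM ⊢
    exact hv.2.2 A B (Finset.union_subset_left hM) (Finset.union_subset_right hM)
  | succ k ih =>
    intro R A B hR hM
    obtain ⟨e, he, heq⟩ := exists_pickVal_false_eq (v := v) k B (nonempty_of_card_eq_succ hR)
    have hset : R.erase e ∪ B ∪ insert e A = R ∪ A ∪ B := by
      ext x
      simp only [Finset.mem_union, Finset.mem_erase, Finset.mem_insert]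
      by_cases hx : x = e
      · simp [hx, he]
      · simp only [hx]
        tauto
    have h := ih (R.erase e) B (insert e A) (card_erase_eq_of_card_eq_succ hR he) (hset ▸ hM)
    rw [hset] at h
    linarith [pickVal_false_le_pickVal_true (v := v) k A he]

/-- Moving first is at least as good as moving second, and being given a remaining item for free
does not hurt, whoever moves next. -/
theorem IsValuation.pickVal_strategy_stealing (hv : IsValuation M v) (k : ℕ) :
    (∀ R T : Finset α, R.card = k → R ∪ T ⊆ M → pickVal v k false R T ≤ pickVal v k true R T) ∧
    ∀ R T : Finset α, R.card = k + 1 → R ∪ T ⊆ M → ∀ e ∈ R, ∀ b : Bool,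
      pickVal v (k + 1) b R T ≤ pickVal v k b (R.erase e) (insert e T) := by
  induction k with
  | zero =>
    refine ⟨fun R T _ _ => le_rfl, fun R T hR hM e he b => ?_⟩
    obtain ⟨a, rfl⟩ := Finset.card_eq_one.1 hR
    obtain rfl := Finset.mem_singleton.1 he
    cases b with
    | false =>
      refine (pickVal_false_succ_le 0 T he).trans (hv.2.1 _ _ (Finset.subset_insert _ _) ?_)
      rwa [Finset.insert_eq]
    | true =>
      obtain ⟨f, hf, heq⟩ := exists_pickVal_true_eq (v := v) 0 T ⟨e, he⟩
      obtain rfl := Finset.mem_singleton.1 hf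
      exact heq.ge
  | succ k ih =>
    obtain ⟨-, hfree⟩ := ih
    have hfirst : ∀ R T : Finset α, R.card = k + 1 → R ∪ T ⊆ M →
        pickVal v (k + 1) false R T ≤ pickVal v (k + 1) true R T := by
      intro R T hR hM
      obtain ⟨e, he⟩ := nonempty_of_card_eq_succ hR
      exact (hfree R T hR hM e he false).trans (pickVal_false_le_pickVal_true k T he)
    refine ⟨hfirst, fun R T hR hM e he b => ?_⟩
    have hcard : (R.erase e).card = k + 1 := card_erase_eq_of_card_eq_succ hR he
    have hRT : ∀ x ∈ R, R.erase x ∪ insert x T ⊆ M := by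
      intro x hx
      refine Finset.Subset.trans ?_ hM
      refine Finset.union_subset ((Finset.erase_subset _ _).trans Finset.subset_union_left) ?_
      exact Finset.insert_subset (Finset.mem_union_left _ hx) Finset.subset_union_right
    cases b with
    | false =>
      obtain ⟨f, hf, heq⟩ := exists_pickVal_false_eq (v := v) k (insert e T)
        (nonempty_of_card_eq_succ hcard)
      obtain ⟨hfe, hfR⟩ := Finset.mem_erase.1 hf
      rw [← heq, Finset.erase_right_comm]
      refine (pickVal_false_succ_le (k + 1) T hfR).trans ?_
      exact hfree (R.erase f) T (card_erase_eq_of_card_eq_succ hR hfR)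
        ((Finset.union_subset_union_left (Finset.erase_subset _ _)).trans hM) e
        (Finset.mem_erase.2 ⟨hfe.symm, he⟩) true
    | true =>
      obtain ⟨f, hf, heq⟩ := exists_pickVal_true_eq (v := v) (k + 1) T ⟨e, he⟩
      rw [← heq]
      by_cases hfe : f = e
      · subst hfe
        exact hfirst _ _ hcard (hRT f hf)
      · have h := hfree (R.erase f) (insert f T) (card_erase_eq_of_card_eq_succ hR hf) (hRT f hf) e
          (Finset.mem_erase.2 ⟨Ne.symm hfe, he⟩) false
        rw [Finset.erase_right_comm, Finset.insert_comm] at h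
        exact h.trans
          (pickVal_false_le_pickVal_true k (insert e T) (Finset.mem_erase.2 ⟨hfe, hf⟩))

/-- Picking first guarantees half of the value of all remaining items. -/
theorem IsValuation.half_le_pickVal_true (hv : IsValuation M v) {k : ℕ} {R : Finset α}
    (hR : R.card = k) (hM : R ⊆ M) : v R / 2 ≤ pickVal v k true R ∅ := by
  have h₁ := hv.le_pickVal_add_pickVal k R ∅ ∅ hR (by simpa using hM)
  have h₂ := (hv.pickVal_strategy_stealing k).1 R ∅ hR (by simpa using hM)
  simp only [Finset.union_empty] at h₁
  linarith

end PickingGame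

theorem stmt11 {α : Type*} [DecidableEq α] (M : Finset α) (hM : M.Nonempty)
    (v : Finset α → ℝ) (hv : IsValuation M v) :
    omegaQ M v ≥ (v M - M.sup' hM fun e => v M - v (M.erase e)) / 2 := by
  obtain ⟨k, hk⟩ : ∃ k, M.card = k + 1 := Nat.exists_eq_succ_of_ne_zero hM.card_ne_zero
  obtain ⟨e, he, heq⟩ := exists_pickVal_false_eq (v := v) k ∅ hM
  have h₁ := hv.half_le_pickVal_true (card_erase_eq_of_card_eq_succ hk he) (M.erase_subset e)
  have h₂ := Finset.le_sup' (fun e => v M - v (M.erase e)) he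
  rw [omegaQ, hk, ← heq]
  linarith
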